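/- Let E be a graph and R a commutative ring with unit. Let x ∈ L_R(E) be a nonzero polynomial in real edges. If there exists a vertex v ∈ E⁰ with xv = x, then for every edge e ∈ E¹ with s(e) = v we have xe ≠ 0. -/

import Mathlib

set_option maxHeartbeats 1000000
set_option synthInstance.maxHeartbeats 400000

noncomputable section

/-- A directed graph `E = (E⁰, E¹, r, s)` with countable vertex and edge sets,
together with range and source maps. -/
structure LPAGraph : Type 1 where
  V : Type
  E : Type
  countV : Countable V
  countE : Countable E
  src : E → V
  rng : E → V

namespace LPAGraph

/-- Generators of the Leavitt path algebra: vertices, real edges, and ghost edges. -/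
inductive LGen (G : LPAGraph) : Type
  | vert : G.V → LGen G
  | edge : G.E → LGen G
  | ghost : G.E → LGen G

/-- `IsPathFrom G u es w` : the list of edges `es` is a path from `u` to `w`
(paths of length zero are vertices). -/
inductive IsPathFrom (G : LPAGraph) : G.V → List G.E → G.V → Prop
  | nil (v : G.V) : IsPathFrom G v [] v
  | cons {u w : G.V} (e : G.E) {es : List G.E} (h : G.src e = u)
      (ht : IsPathFrom G (G.rng e) es w) : IsPathFrom G u (e :: es) w

/-- A vertex is regular if it emits at least one and only finitely many edges. -/
def Regular (G : LPAGraph) (v : G.V) : Prop :=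
  {e : G.E | G.src e = v}.Finite ∧ {e : G.E | G.src e = v}.Nonempty

/-- A graph is row-finite if every vertex emits only finitely many edges. -/
def RowFinite (G : LPAGraph) : Prop := ∀ v : G.V, {e : G.E | G.src e = v}.Finite

/-- A subset `H` of vertices is hereditary if `s(e) ∈ H` implies `r(e) ∈ H`. -/
def Hereditary (G : LPAGraph) (H : Set G.V) : Prop :=
  ∀ e : G.E, G.src e ∈ H → G.rng e ∈ H

/-- A subset `H` of vertices is saturated if every regular vertex, all of whose emitted
edges have range in `H`, belongs to `H`. -/
def Saturated (G : LPAGraph) (H : Set G.V) : Prop :=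
  ∀ v : G.V, G.Regular v → (∀ e : G.E, G.src e = v → G.rng e ∈ H) → v ∈ H

/-- The saturation of a set of vertices: the smallest saturated hereditary subset
containing it. -/
def saturation (G : LPAGraph) (X : Set G.V) : Set G.V :=
  ⋂₀ {H : Set G.V | G.Hereditary H ∧ G.Saturated H ∧ X ⊆ H}

/-- `HasExit G es` : the path `es` has an exit, i.e. there is an edge `f` with
`s(f) = s(eᵢ)` and `f ≠ eᵢ` for some `i`. -/
def HasExit (G : LPAGraph) (es : List G.E) : Prop :=
  ∃ (f : G.E) (i : Fin es.length), G.src f = G.src (es.get i) ∧ f ≠ es.get i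

/-- Condition (L): every cycle has an exit. -/
def CondL (G : LPAGraph) : Prop :=
  ∀ (v : G.V) (es : List G.E), es ≠ [] → IsPathFrom G v es v → G.HasExit es

/-- A closed path based at `v`. -/
def IsClosedPathAt (G : LPAGraph) (v : G.V) (es : List G.E) : Prop :=
  es ≠ [] ∧ IsPathFrom G v es v

/-- A simple closed path based at `v` : a closed path `e₁ … eₙ` based at `v` with
`s(eᵢ) ≠ v` for `i = 2, …, n`. -/
def IsSimpleClosedPathAt (G : LPAGraph) (v : G.V) (es : List G.E) : Prop :=
  G.IsClosedPathAt v es ∧ ∀ i : Fin es.length, i.1 ≠ 0 → G.src (es.get i) ≠ v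

/-- Condition (K): every vertex is the base of no closed path or of at least two
distinct simple closed paths. -/
def CondK (G : LPAGraph) : Prop :=
  ∀ v : G.V, (¬ ∃ es : List G.E, G.IsClosedPathAt v es) ∨
    (∃ es₁ es₂ : List G.E, G.IsSimpleClosedPathAt v es₁ ∧ G.IsSimpleClosedPathAt v es₂ ∧
      es₁ ≠ es₂)

variable (R : Type) [CommRing R] (G : LPAGraph)

open FreeAlgebra in
/-- The defining relations of the Leavitt path algebra (the relations of a
Leavitt `E`-family). -/
inductive LeavittRel : FreeAlgebra R (LGen G) → FreeAlgebra R (LGen G) → Prop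
  | vert_mul_self (v : G.V) :
      LeavittRel (ι R (LGen.vert v) * ι R (LGen.vert v)) (ι R (LGen.vert v))
  | vert_mul_vert (v w : G.V) (hvw : v ≠ w) :
      LeavittRel (ι R (LGen.vert v) * ι R (LGen.vert w)) 0
  | src_mul_edge (e : G.E) :
      LeavittRel (ι R (LGen.vert (G.src e)) * ι R (LGen.edge e)) (ι R (LGen.edge e))
  | edge_mul_rng (e : G.E) :
      LeavittRel (ι R (LGen.edge e) * ι R (LGen.vert (G.rng e))) (ι R (LGen.edge e))
  | rng_mul_ghost (e : G.E) :
      LeavittRel (ι R (LGen.vert (G.rng e)) * ι R (LGen.ghost e)) (ι R (LGen.ghost e))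
  | ghost_mul_src (e : G.E) :
      LeavittRel (ι R (LGen.ghost e) * ι R (LGen.vert (G.src e))) (ι R (LGen.ghost e))
  | ghost_mul_self (e : G.E) :
      LeavittRel (ι R (LGen.ghost e) * ι R (LGen.edge e)) (ι R (LGen.vert (G.rng e)))
  | ghost_mul_edge (e f : G.E) (hef : e ≠ f) :
      LeavittRel (ι R (LGen.ghost e) * ι R (LGen.edge f)) 0
  | ck (v : G.V) (s : Finset G.E) (hs : ∀ e : G.E, e ∈ s ↔ G.src e = v) (hne : s.Nonempty) :
      LeavittRel (ι R (LGen.vert v)) (∑ e ∈ s, ι R (LGen.edge e) * ι R (LGen.ghost e))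

/-- The ambient unital algebra: the universal unital `R`-algebra on the Leavitt relations. -/
abbrev Ambient : Type := RingQuot (LeavittRel R G)

/-- The images of the generators in the ambient algebra. -/
def ugen (x : LGen G) : Ambient R G :=
  RingQuot.mkAlgHom R (LeavittRel R G) (FreeAlgebra.ι R x)

/-- The Leavitt path algebra `L_R(E)`, realized as the non-unital subalgebra of the ambient
algebra generated by the Leavitt `E`-family (equivalently, the span of words in the
generators). -/
def LeavittSubalgebra : NonUnitalSubalgebra R (Ambient R G) :=
  NonUnitalAlgebra.adjoin R (Set.range (ugen R G))

/-- The Leavitt path algebra `L_R(E)` as a type; it is a non-unital `R`-algebra. -/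
abbrev LeavittPathAlgebra : Type := ↥(LeavittSubalgebra R G)

theorem ugen_mem (x : LGen G) : ugen R G x ∈ LeavittSubalgebra R G :=
  NonUnitalAlgebra.subset_adjoin R (Set.mem_range_self x)

/-- The vertex idempotent `v ∈ L_R(E)`. -/
def vertexElem (v : G.V) : LeavittPathAlgebra R G :=
  ⟨ugen R G (LGen.vert v), ugen_mem R G _⟩

/-- The real edge `e ∈ L_R(E)`. -/
def edgeElem (e : G.E) : LeavittPathAlgebra R G :=
  ⟨ugen R G (LGen.edge e), ugen_mem R G _⟩

/-- The ghost edge `e* ∈ L_R(E)`. -/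
def ghostElem (e : G.E) : LeavittPathAlgebra R G :=
  ⟨ugen R G (LGen.ghost e), ugen_mem R G _⟩

/-- The element `α = e₁ ⋯ eₙ` of the ambient algebra corresponding to a path; a path of
length zero starting at `u` is the vertex `u`. -/
def uPath (u : G.V) (es : List G.E) : Ambient R G :=
  ugen R G (LGen.vert u) * (es.map fun e => ugen R G (LGen.edge e)).prod

/-- The element `α* = eₙ* ⋯ e₁*` of the ambient algebra corresponding to a ghost path. -/
def uGhostPath (u : G.V) (es : List G.E) : Ambient R G :=
  ((es.map fun e => ugen R G (LGen.ghost e)).reverse).prod * ugen R G (LGen.vert u)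

private theorem list_prod_mem_aux (f : G.E → Ambient R G)
    (hf : ∀ e, f e ∈ LeavittSubalgebra R G) :
    ∀ es : List G.E, es ≠ [] → (es.map f).prod ∈ LeavittSubalgebra R G
  | [], h => absurd rfl h
  | [e], _ => by simpa using hf e
  | e :: e' :: t, _ => by
      rw [List.map_cons, List.prod_cons]
      exact mul_mem (hf e) (list_prod_mem_aux f hf (e' :: t) (by simp))

theorem uPath_mem (u : G.V) (es : List G.E) : uPath R G u es ∈ LeavittSubalgebra R G := by
  cases es with
  | nil => simpa [uPath] using ugen_mem R G (LGen.vert u)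
  | cons e t =>
      exact mul_mem (ugen_mem R G (LGen.vert u))
        (list_prod_mem_aux R G _ (fun e => ugen_mem R G (LGen.edge e)) (e :: t) (by simp))

theorem uGhostPath_mem (u : G.V) (es : List G.E) :
    uGhostPath R G u es ∈ LeavittSubalgebra R G := by
  cases es with
  | nil => simpa [uGhostPath] using ugen_mem R G (LGen.vert u)
  | cons e t =>
      rw [uGhostPath, ← List.map_reverse]
      exact mul_mem
        (list_prod_mem_aux R G _ (fun e => ugen_mem R G (LGen.ghost e)) ((e :: t).reverse)
          (by simp))
        (ugen_mem R G (LGen.vert u))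

/-- The element of `L_R(E)` corresponding to the path `α` with source `u` and edge list
`es` (for `es = []` this is the vertex `u`). -/
def pathElem (u : G.V) (es : List G.E) : LeavittPathAlgebra R G :=
  ⟨uPath R G u es, uPath_mem R G u es⟩

/-- The element of `L_R(E)` corresponding to the ghost path `α*` where `α` has source `u`
and edge list `es` (for `es = []` this is the vertex `u`). -/
def ghostPathElem (u : G.V) (es : List G.E) : LeavittPathAlgebra R G :=
  ⟨uGhostPath R G u es, uGhostPath_mem R G u es⟩

/-- The set of monomials `α β*` where `α, β` are paths with `r(α) = r(β)`. -/
def monomialSet : Set (LeavittPathAlgebra R G) :=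
  {x | ∃ (u : G.V) (es : List G.E) (u' : G.V) (es' : List G.E) (w : G.V),
    IsPathFrom G u es w ∧ IsPathFrom G u' es' w ∧
    x = pathElem R G u es * ghostPathElem R G u' es'}

/-- The degree-`k` homogeneous component `L_R(E)ₖ` of the canonical `ℤ`-grading:
the `R`-span of the monomials `α β*` with `|α| - |β| = k`. -/
def component (k : ℤ) : Submodule R (LeavittPathAlgebra R G) :=
  Submodule.span R
    {x | ∃ (u : G.V) (es : List G.E) (u' : G.V) (es' : List G.E) (w : G.V),
      IsPathFrom G u es w ∧ IsPathFrom G u' es' w ∧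
      (es.length : ℤ) - (es'.length : ℤ) = k ∧
      x = pathElem R G u es * ghostPathElem R G u' es'}

/-- An ideal `I` of `L_R(E)` is basic if `r • v ∈ I` with `r ∈ R \ {0}` and `v` a vertex
implies `v ∈ I`. -/
def IsBasicIdeal (I : TwoSidedIdeal (LeavittPathAlgebra R G)) : Prop :=
  ∀ (r : R) (v : G.V), r ≠ 0 → r • vertexElem R G v ∈ I → vertexElem R G v ∈ I

/-- An ideal `I` of the `ℤ`-graded ring `L_R(E)` is graded if `I = ⊕ₖ (I ∩ L_R(E)ₖ)`,
i.e. every element of `I` is a finite sum of homogeneous elements of `I`. -/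
def IsGradedIdeal (I : TwoSidedIdeal (LeavittPathAlgebra R G)) : Prop :=
  ∀ x ∈ I, ∃ (n : ℕ) (c : Fin n → LeavittPathAlgebra R G),
    (∀ i, c i ∈ I ∧ ∃ k : ℤ, c i ∈ component R G k) ∧ x = ∑ i, c i

/-- The two-sided ideal of `L_R(E)` generated by the vertices in a set `H` of vertices. -/
def idealOfSet (H : Set G.V) : TwoSidedIdeal (LeavittPathAlgebra R G) :=
  TwoSidedIdeal.span {x | ∃ v ∈ H, x = vertexElem R G v}

/-- `x ∈ L_R(E)` is a polynomial in only real edges if it is an `R`-linear combination of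
(real) paths. -/
def IsRealPoly (x : LeavittPathAlgebra R G) : Prop :=
  x ∈ Submodule.span R
    {y | ∃ (u : G.V) (es : List G.E) (w : G.V), IsPathFrom G u es w ∧ y = pathElem R G u es}

end LPAGraph

namespace LPAGraph

section Aux

theorem exists_sigma (G : LPAGraph) : ∃ σ : G.E → ℕ → ℕ,
    (∀ e f n m, G.src e = G.src f → σ e n = σ f m → e = f ∧ n = m) ∧
    (∀ e k, ∃ f n, G.src f = G.src e ∧ σ f n = k) := by
  have h : ∀ v : G.V, ∃ f : {e : G.E // G.src e = v} × ℕ → ℕ, Function.Injective f ∧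
      (Nonempty {e : G.E // G.src e = v} → Function.Surjective f) := by
    intro v
    have := G.countE
    by_cases hn : Nonempty {e : G.E // G.src e = v}
    · obtain ⟨g⟩ := nonempty_equiv_of_countable (α := {e : G.E // G.src e = v} × ℕ) (β := ℕ)
      exact ⟨g, g.injective, fun _ => g.surjective⟩
    · refine ⟨fun _ => 0, fun a => (hn ⟨a.1⟩).elim, fun h => (hn h).elim⟩
  choose F hF hS using h
  refine ⟨fun e n => F (G.src e) (⟨e, rfl⟩, n), ?_, ?_⟩
  · intro e f n m hef h
    have key : ∀ (v : G.V) (h1 : G.src e = v) (h2 : G.src f = v),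
        F v (⟨e, h1⟩, n) = F v (⟨f, h2⟩, m) → e = f ∧ n = m := by
      intro v h1 h2 h
      have := hF v h
      simpa using this
    refine key (G.src f) hef rfl ?_
    refine Eq.trans ?_ h
    have : ∀ (v : G.V) (h1 : G.src e = v), F v (⟨e, h1⟩, n) = F (G.src e) (⟨e, rfl⟩, n) := by
      rintro v rfl; rfl
    exact this _ hef
  · intro e k
    obtain ⟨⟨⟨f, hf⟩, n⟩, h⟩ := hS (G.src e) ⟨⟨e, rfl⟩⟩ k
    refine ⟨f, n, hf, ?_⟩
    rw [← h]
    have : ∀ (v : G.V) (h1 : G.src f = v), F (G.src f) (⟨f, rfl⟩, n) = F v (⟨f, h1⟩, n) := by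
      rintro v rfl; rfl
    exact this _ hf

def sig (G : LPAGraph) : G.E → ℕ → ℕ := (exists_sigma G).choose

theorem sig_inj (G : LPAGraph) {e f : G.E} {n m : ℕ} (h : G.src e = G.src f)
    (h' : sig G e n = sig G f m) : e = f ∧ n = m :=
  (exists_sigma G).choose_spec.1 e f n m h h'

theorem sig_surj (G : LPAGraph) (e : G.E) (k : ℕ) : ∃ f n, G.src f = G.src e ∧ sig G f n = k :=
  (exists_sigma G).choose_spec.2 e k

abbrev Pt (G : LPAGraph) : Type := G.V × ℕ × ℤ

variable (R : Type) [CommRing R] (G : LPAGraph)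

abbrev Mod : Type := Pt G →₀ R

open Classical in
def genFun : LGen G → Pt G → Mod R G
  | .vert v, p => if p.1 = v then Finsupp.single p 1 else 0
  | .edge e, p => if p.1 = G.rng e then
      Finsupp.single (G.src e, sig G e p.2.1, p.2.2 + 1) 1 else 0
  | .ghost e, p => if h : p.1 = G.src e ∧ ∃ m, sig G e m = p.2.1 then
      Finsupp.single (G.rng e, h.2.choose, p.2.2 - 1) 1 else 0

def genMap (g : LGen G) : Module.End R (Mod R G) :=
  Finsupp.linearCombination R (genFun R G g)

theorem vert_same (v : G.V) (n : ℕ) (k : ℤ) :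
    genMap R G (.vert v) (Finsupp.single (v, n, k) 1) = Finsupp.single (v, n, k) 1 := by
  simp [genMap, genFun]

theorem vert_ne {v w : G.V} (h : w ≠ v) (n : ℕ) (k : ℤ) :
    genMap R G (.vert v) (Finsupp.single (w, n, k) 1) = 0 := by
  simp [genMap, genFun, h]

theorem edge_same (e : G.E) (n : ℕ) (k : ℤ) :
    genMap R G (.edge e) (Finsupp.single (G.rng e, n, k) 1) =
      Finsupp.single (G.src e, sig G e n, k + 1) 1 := by
  simp [genMap, genFun]

theorem edge_ne {e : G.E} {w : G.V} (h : w ≠ G.rng e) (n : ℕ) (k : ℤ) :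
    genMap R G (.edge e) (Finsupp.single (w, n, k) 1) = 0 := by
  simp [genMap, genFun, h]

theorem ghost_same (e : G.E) (n : ℕ) (k : ℤ) :
    genMap R G (.ghost e) (Finsupp.single (G.src e, sig G e n, k) 1) =
      Finsupp.single (G.rng e, n, k - 1) 1 := by
  have h : ∃ m, sig G e m = sig G e n := ⟨n, rfl⟩
  have hc : h.choose = n := (sig_inj G rfl h.choose_spec).2
  simp only [genMap, genFun, Finsupp.linearCombination_single, one_smul]
  rw [dif_pos ⟨rfl, h⟩, hc]

theorem ghost_ne_src {e : G.E} {w : G.V} (h : w ≠ G.src e) (n : ℕ) (k : ℤ) :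
    genMap R G (.ghost e) (Finsupp.single (w, n, k) 1) = 0 := by
  simp [genMap, genFun, h]

theorem ghost_ne {e f : G.E} (h : e ≠ f) (n : ℕ) (k : ℤ) :
    genMap R G (.ghost e) (Finsupp.single (G.src f, sig G f n, k) 1) = 0 := by
  simp only [genMap, genFun, Finsupp.linearCombination_single, one_smul]
  rw [dif_neg]
  rintro ⟨h1, m, hm⟩
  exact h (sig_inj G h1.symm hm).1

theorem end_ext {f g : Module.End R (Mod R G)}
    (h : ∀ w n k, f (Finsupp.single (w, n, k) 1) = g (Finsupp.single (w, n, k) 1)) : f = g := by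
  refine Finsupp.lhom_ext' fun p => LinearMap.ext_ring ?_
  exact h p.1 p.2.1 p.2.2

theorem genMap_rel : ∀ ⦃x y : FreeAlgebra R (LGen G)⦄, LeavittRel R G x y →
    FreeAlgebra.lift R (genMap R G) x = FreeAlgebra.lift R (genMap R G) y := by
  intro x y h
  induction h with
  | vert_mul_self v =>
    simp only [map_mul, FreeAlgebra.lift_ι_apply]
    refine end_ext R G fun w n k => ?_
    rw [Module.End.mul_apply]
    by_cases h : w = v
    · subst h; simp only [vert_same]
    · simp only [vert_ne R G h, map_zero]
  | vert_mul_vert v v' hv =>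
    simp only [map_mul, FreeAlgebra.lift_ι_apply, map_zero]
    refine end_ext R G fun w n k => ?_
    rw [Module.End.mul_apply]
    by_cases h : w = v'
    · subst h; simp only [vert_same, vert_ne R G hv.symm, LinearMap.zero_apply]
    · simp only [vert_ne R G h, map_zero, LinearMap.zero_apply]
  | src_mul_edge e =>
    simp only [map_mul, FreeAlgebra.lift_ι_apply]
    refine end_ext R G fun w n k => ?_
    rw [Module.End.mul_apply]
    by_cases h : w = G.rng e
    · subst h; simp only [vert_same, edge_same]
    · simp only [edge_ne R G h, map_zero]
  | edge_mul_rng e =>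
    simp only [map_mul, FreeAlgebra.lift_ι_apply]
    refine end_ext R G fun w n k => ?_
    rw [Module.End.mul_apply]
    by_cases h : w = G.rng e
    · subst h; simp only [vert_same]
    · simp only [edge_ne R G h, vert_ne R G h, map_zero]
  | rng_mul_ghost e =>
    simp only [map_mul, FreeAlgebra.lift_ι_apply]
    refine end_ext R G fun w n k => ?_
    rw [Module.End.mul_apply]
    by_cases h : w = G.src e
    · obtain ⟨f, m, hf, rfl⟩ := sig_surj G e n
      rw [h, ← hf]
      by_cases hef : e = f
      · subst hef; simp only [ghost_same, vert_same]
      · simp only [ghost_ne R G hef, map_zero]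
    · simp only [ghost_ne_src R G h, map_zero]
  | ghost_mul_src e =>
    simp only [map_mul, FreeAlgebra.lift_ι_apply]
    refine end_ext R G fun w n k => ?_
    rw [Module.End.mul_apply]
    by_cases h : w = G.src e
    · subst h; simp only [vert_same]
    · simp only [ghost_ne_src R G h, vert_ne R G h, map_zero]
  | ghost_mul_self e =>
    simp only [map_mul, FreeAlgebra.lift_ι_apply]
    refine end_ext R G fun w n k => ?_
    rw [Module.End.mul_apply]
    by_cases h : w = G.rng e
    · subst h; simp only [edge_same, ghost_same, vert_same, add_sub_cancel_right]
    · simp only [edge_ne R G h, vert_ne R G h, map_zero]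
  | ghost_mul_edge e f hef =>
    simp only [map_mul, FreeAlgebra.lift_ι_apply, map_zero]
    refine end_ext R G fun w n k => ?_
    rw [Module.End.mul_apply]
    by_cases h : w = G.rng f
    · subst h; simp only [edge_same, ghost_ne R G hef, LinearMap.zero_apply]
    · simp only [edge_ne R G h, map_zero, LinearMap.zero_apply]
  | ck v s hs hne =>
    simp only [map_sum, map_mul, FreeAlgebra.lift_ι_apply]
    refine end_ext R G fun w n k => ?_
    rw [LinearMap.sum_apply]
    simp only [Module.End.mul_apply]
    by_cases h : w = v
    · subst h
      obtain ⟨e, he⟩ := hne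
      obtain ⟨f, m, hf, rfl⟩ := sig_surj G e n
      rw [(hs e).1 he] at hf
      subst hf
      rw [Finset.sum_eq_single f]
      · simp only [vert_same, ghost_same, edge_same, sub_add_cancel]
      · intro b _ hb
        rw [ghost_ne R G hb, map_zero]
      · intro h; exact (h ((hs f).2 rfl)).elim
    · rw [vert_ne R G h, Finset.sum_eq_zero]
      intro e he
      rw [ghost_ne_src R G, map_zero]
      rw [(hs e).1 he]; exact h

def rep : Ambient R G →ₐ[R] Module.End R (Mod R G) :=
  RingQuot.liftAlgHom R ⟨FreeAlgebra.lift R (genMap R G), genMap_rel R G⟩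

theorem rep_ugen (g : LGen G) : rep R G (ugen R G g) = genMap R G g := by
  simp [rep, ugen, RingQuot.liftAlgHom_mkAlgHom_apply]

def foldSig : List G.E → ℕ → ℕ
  | [], n => n
  | e :: es, n => sig G e (foldSig es n)

theorem rel_eq {a b : FreeAlgebra R (LGen G)} (h : LeavittRel R G a b) :
    RingQuot.mkAlgHom R (LeavittRel R G) a = RingQuot.mkAlgHom R (LeavittRel R G) b :=
  RingQuot.mkAlgHom_rel R h

theorem uPath_cons (e : G.E) (es : List G.E) :
    uPath R G (G.src e) (e :: es) = ugen R G (.edge e) * uPath R G (G.rng e) es := by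
  have h1 : ugen R G (.vert (G.src e)) * ugen R G (.edge e) = ugen R G (.edge e) := by
    simpa [ugen] using rel_eq R G (LeavittRel.src_mul_edge e)
  have h2 : ugen R G (.edge e) * ugen R G (.vert (G.rng e)) = ugen R G (.edge e) := by
    simpa [ugen] using rel_eq R G (LeavittRel.edge_mul_rng e)
  rw [uPath, uPath, List.map_cons, List.prod_cons, ← mul_assoc, ← mul_assoc, h1, h2]

theorem uPath_mul_vert {u w : G.V} {es : List G.E} (h : IsPathFrom G u es w) :
    uPath R G u es * ugen R G (.vert w) = uPath R G u es := by
  induction h with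
  | nil v =>
    simpa [uPath, ugen] using rel_eq R G (LeavittRel.vert_mul_self v)
  | cons e h ht ih => subst h; rw [uPath_cons, mul_assoc, ih]

theorem uPath_mul_vert_ne {u w v : G.V} {es : List G.E} (h : IsPathFrom G u es w)
    (hv : w ≠ v) : uPath R G u es * ugen R G (.vert v) = 0 := by
  have h0 : ugen R G (.vert w) * ugen R G (.vert v) = 0 := by
    simpa [ugen] using rel_eq R G (LeavittRel.vert_mul_vert w v hv)
  rw [← uPath_mul_vert R G h, mul_assoc, h0, mul_zero]

theorem rep_uPath {u w : G.V} {es : List G.E} (h : IsPathFrom G u es w) (n : ℕ) (k : ℤ) :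
    rep R G (uPath R G u es) (Finsupp.single (w, n, k) 1) =
      Finsupp.single (u, foldSig G es n, k + es.length) 1 := by
  induction h with
  | nil v => simp [uPath, rep_ugen, vert_same, foldSig]
  | cons e h ht ih =>
    subst h
    rw [uPath_cons, map_mul, Module.End.mul_apply, ih, rep_ugen, edge_same]
    simp [foldSig, add_assoc]

theorem path_inj {u v : G.V} {es : List G.E} (h : IsPathFrom G u es v) {fs : List G.E}
    (h' : IsPathFrom G u fs v) (hl : es.length = fs.length) (n : ℕ)
    (hn : foldSig G es n = foldSig G fs n) : es = fs := by
  induction h generalizing fs with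
  | nil v => simpa [eq_comm] using hl
  | cons e h ht ih =>
    cases h' with
    | nil => simp at hl
    | cons f hf hft =>
      obtain ⟨rfl, hm⟩ := sig_inj G (h.trans hf.symm) hn
      rw [ih hft (by simpa using hl) hm]

end Aux

end LPAGraph

open LPAGraph in
/-- **Lemma.**  Let `x ∈ L_R(E)` be a nonzero polynomial in real edges.  If there is a
vertex `v` with `x v = x`, then for every edge `e` with `s(e) = v` we have `x e ≠ 0`. -/
theorem stmt8 (R : Type) [CommRing R] (G : LPAGraph)
    (x : LeavittPathAlgebra R G) (hx : IsRealPoly R G x) (hx0 : x ≠ 0)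
    (v : G.V) (hxv : x * vertexElem R G v = x)
    (e : G.E) (he : G.src e = v) :
    x * edgeElem R G e ≠ 0 := by
  classical
  intro hxe
  apply hx0
  let I := {p : G.V × List G.E × G.V // IsPathFrom G p.1 p.2.1 p.2.2}
  let P : I → LeavittPathAlgebra R G := fun p => pathElem R G p.1.1 p.1.2.1
  have hset : {y | ∃ (u : G.V) (es : List G.E) (w : G.V),
      IsPathFrom G u es w ∧ y = pathElem R G u es} = Set.range P := by
    ext y
    constructor
    · rintro ⟨u, es, w, h, rfl⟩
      exact ⟨⟨(u, es, w), h⟩, rfl⟩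
    · rintro ⟨⟨⟨u, es, w⟩, h⟩, rfl⟩
      exact ⟨u, es, w, h, rfl⟩
  unfold IsRealPoly at hx
  rw [hset, Finsupp.mem_span_range_iff_exists_finsupp] at hx
  obtain ⟨c, hc⟩ := hx
  -- keep only the paths ending at `v`
  have hval : (x : Ambient R G) =
      ∑ p ∈ c.support with p.1.2.2 = v, c p • uPath R G p.1.1 p.1.2.1 := by
    have h1 : (x : Ambient R G) * ugen R G (.vert v) = x := congrArg Subtype.val hxv
    have h2 : (x : Ambient R G) = ∑ p ∈ c.support, c p • uPath R G p.1.1 p.1.2.1 := by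
      rw [← hc, Finsupp.sum]
      simp [P, pathElem]
    rw [← h1, h2, Finset.sum_mul, Finset.sum_filter]
    refine Finset.sum_congr rfl fun p _ => ?_
    split_ifs with hp
    · subst hp
      rw [smul_mul_assoc, uPath_mul_vert R G p.2]
    · rw [smul_mul_assoc, uPath_mul_vert_ne R G p.2 hp, smul_zero]
  have hxe' : (x : Ambient R G) * ugen R G (.edge e) = 0 := congrArg Subtype.val hxe
  have hrep := congrArg (fun y => rep R G y (Finsupp.single (G.rng e, 0, 0) 1)) hxe'
  simp only [map_mul, Module.End.mul_apply, rep_ugen, edge_same, map_zero,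
    LinearMap.zero_apply, he] at hrep
  rw [hval, map_sum, LinearMap.sum_apply] at hrep
  let pt : I → Pt G := fun p =>
    (p.1.1, foldSig G p.1.2.1 (sig G e 0), (0 + 1 : ℤ) + (p.1.2.1.length : ℤ))
  have hsum : ∑ p ∈ c.support with p.1.2.2 = v, c p • Finsupp.single (pt p) (1 : R) = 0 := by
    rw [← hrep]
    refine Finset.sum_congr rfl fun p hp => ?_
    have hpv : p.1.2.2 = v := (Finset.mem_filter.1 hp).2
    subst hpv
    rw [map_smul, LinearMap.smul_apply, rep_uPath R G p.2]
  apply Subtype.ext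
  rw [hval]
  refine Finset.sum_eq_zero fun p hp => ?_
  have hpv : p.1.2.2 = v := (Finset.mem_filter.1 hp).2
  have h0 := DFunLike.congr_fun hsum (pt p)
  rw [Finsupp.finsetSum_apply, Finset.sum_eq_single p] at h0
  · have : c p = 0 := by simpa using h0
    rw [this, zero_smul]
  · intro q hq hqp
    have hqv : q.1.2.2 = v := (Finset.mem_filter.1 hq).2
    rw [Finsupp.smul_apply, Finsupp.single_eq_of_ne, smul_zero]
    intro h
    apply hqp
    obtain ⟨⟨u, es, w⟩, hq'⟩ := q
    obtain ⟨⟨u', es', w'⟩, hp'⟩ := p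
    simp only [pt, Prod.mk.injEq] at h hqv hpv hq' hp'
    obtain ⟨rfl, h2, h3⟩ := h
    subst hqv hpv
    have := path_inj G hq' hp' (by omega) _ (by first | exact h2 | exact h2.symm)
    subst this
    rfl
  · intro h; exact (h hp).elim
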